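/- Let G be an almost Moore digraph of degree d > 1 and diameter k > 1, let α > 1 be an integer, and let v be a vertex of H_α with out-neighbours N⁺(v) = {v₁,…,v_d}. For 1 ≤ j ≤ d let T(v_j) be the set of vertices w of G such that some shortest walk from v to w passes through v_j. If (z,v) is an arc of G with z ∈ T(v_j), then v_j ∈ H_α if and only if z ∈ H_α. -/

import Mathlib

/-- `IsWalkFrom A u v l` : the list `u :: l` is a directed walk from `u` to `v`
along the adjacency relation `A`; the length of the walk is `l.length`. -/
def IsWalkFrom {V : Type} (A : V → V → Prop) (u v : V) (l : List V) : Prop :=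
  List.Chain A u l ∧ (u :: l).getLast (List.cons_ne_nil u l) = v

/-- An almost Moore digraph (a `(d,k)`-digraph): a diregular digraph of degree `d > 1`,
diameter `k > 1` and order `d + d² + ⋯ + d^k`, together with its repeat permutation `rep`:
for every vertex `v`, every vertex `w ≠ rep v` is reached from `v` by exactly one walk of
length at most `k`, while `rep v` is reached by exactly two such walks, at least one of
which has length `k`.  The map `rep` is an automorphism of the digraph. -/
structure AlmostMooreDigraph (d k : ℕ) where
  hd : 1 < d
  hk : 1 < k
  V : Type
  [fintypeV : Fintype V]
  [decEqV : DecidableEq V]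
  Adj : V → V → Prop
  [adjDec : DecidableRel Adj]
  loopless : ∀ v, ¬ Adj v v
  out_deg : ∀ v, {w | Adj v w}.ncard = d
  in_deg : ∀ v, {w | Adj w v}.ncard = d
  reach : ∀ u v, ∃ l, IsWalkFrom Adj u v l ∧ l.length ≤ k
  diam : ∃ u v, ∀ l, IsWalkFrom Adj u v l → k ≤ l.length
  card_eq : Fintype.card V = ∑ i ∈ Finset.range k, d ^ (i + 1)
  rep : V → V
  rep_spec : ∀ v w, w ≠ rep v → ∃! l, IsWalkFrom Adj v w l ∧ l.length ≤ k
  rep_two : ∀ v, ∃ l₁ l₂, l₁ ≠ l₂ ∧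
      IsWalkFrom Adj v (rep v) l₁ ∧ l₁.length ≤ k ∧
      IsWalkFrom Adj v (rep v) l₂ ∧ l₂.length ≤ k ∧
      (l₁.length = k ∨ l₂.length = k) ∧
      (∀ l, IsWalkFrom Adj v (rep v) l → l.length ≤ k → l = l₁ ∨ l = l₂)
  rep_bijective : Function.Bijective rep
  rep_adj : ∀ u v, Adj u v ↔ Adj (rep u) (rep v)

attribute [instance] AlmostMooreDigraph.fintypeV AlmostMooreDigraph.decEqV
  AlmostMooreDigraph.adjDec

/-- `ordRep M v` : the smallest `t ≥ 1` with `rep^t v = v`. -/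
noncomputable def ordRep {d k : ℕ} (M : AlmostMooreDigraph d k) (v : M.V) : ℕ :=
  sInf {t | 0 < t ∧ M.rep^[t] v = v}

/-- The vertex set of the subdigraph `H_α`: vertices whose order under the repeat
permutation divides `2^t * α` for some `t ≥ 0`. -/
def Hset {d k : ℕ} (M : AlmostMooreDigraph d k) (α : ℕ) : Set M.V :=
  {v | ∃ t : ℕ, ordRep M v ∣ 2 ^ t * α}

/-- The (walk) distance from `u` to `v` in the digraph: the length of a shortest
directed walk from `u` to `v`. -/
noncomputable def distG {d k : ℕ} (M : AlmostMooreDigraph d k) (u v : M.V) : ℕ :=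
  sInf {n | ∃ l : List M.V, IsWalkFrom M.Adj u v l ∧ l.length = n}

/-- A vertex lies in `H_α` iff it is fixed by some iterate `rep^[2 ^ t * α]`. -/
theorem mem_Hset_iff {d k : ℕ} (M : AlmostMooreDigraph d k) {α : ℕ} (v : M.V) :
    v ∈ Hset M α ↔ ∃ t : ℕ, Function.IsPeriodicPt M.rep (2 ^ t * α) v := by
  have hper : v ∈ Function.periodicPts M.rep := M.rep_bijective.injective.mem_periodicPts v
  have hord : ordRep M v = Function.minimalPeriod M.rep v := by
    have hmin : 0 < Function.minimalPeriod M.rep v ∧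
        M.rep^[Function.minimalPeriod M.rep v] v = v :=
      ⟨Function.minimalPeriod_pos_of_mem_periodicPts hper,
        Function.isPeriodicPt_minimalPeriod M.rep v⟩
    have hmem : ordRep M v ∈ {t | 0 < t ∧ M.rep^[t] v = v} := Nat.sInf_mem ⟨_, hmin⟩
    exact le_antisymm (Nat.sInf_le hmin)
      (Function.IsPeriodicPt.minimalPeriod_le hmem.1 hmem.2)
  simp only [Hset, Set.mem_ofPred_eq, hord, Function.isPeriodicPt_iff_minimalPeriod_dvd]

/-- Two vertices of `H_α` are fixed by a common iterate of `rep`. -/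
theorem exists_common_period {d k : ℕ} (M : AlmostMooreDigraph d k) {α : ℕ} {u v : M.V}
    (hu : u ∈ Hset M α) (hv : v ∈ Hset M α) :
    ∃ t : ℕ, M.rep^[2 ^ t * α] u = u ∧ M.rep^[2 ^ t * α] v = v := by
  obtain ⟨s, hs⟩ := (mem_Hset_iff M u).1 hu
  obtain ⟨t, ht⟩ := (mem_Hset_iff M v).1 hv
  exact ⟨max s t,
    hs.trans_dvd (Nat.mul_dvd_mul_right (pow_dvd_pow 2 (le_max_left s t)) α),
    ht.trans_dvd (Nat.mul_dvd_mul_right (pow_dvd_pow 2 (le_max_right s t)) α)⟩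

theorem IsWalkFrom.map {V : Type} {A : V → V → Prop} {f : V → V}
    (hf : ∀ a b, A a b → A (f a) (f b)) {u w : V} {l : List V} (h : IsWalkFrom A u w l) :
    IsWalkFrom A (f u) (f w) (l.map f) := by
  refine ⟨?_, ?_⟩
  · exact List.isChain_map_of_isChain f hf h.1
  · have := h.2
    have h2 := List.getLast_map (f := f) (l := u :: l) (by simp)
    simpa [this] using h2

theorem IsWalkFrom.concat {V : Type} {A : V → V → Prop} {u w x : V} {l : List V}
    (h : IsWalkFrom A u w l) (hwx : A w x) : IsWalkFrom A u x (l ++ [x]) := by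
  refine ⟨?_, by simp⟩
  have h2 := h.2
  change List.IsChain A ((u :: l) ++ [x])
  rw [List.isChain_append]
  refine ⟨h.1, by simp, ?_⟩
  intro a ha b hb
  rw [List.getLast?_eq_getLast_of_ne_nil (List.cons_ne_nil u l), h2] at ha
  simp at ha hb
  subst ha hb
  exact hwx

theorem IsWalkFrom.suffix {V : Type} {A : V → V → Prop} {u w x : V} {s t : List V}
    (h : IsWalkFrom A u w (s ++ x :: t)) : IsWalkFrom A x w t := by
  refine ⟨?_, ?_⟩
  · have h1 : List.IsChain A ((u :: s) ++ x :: t) := h.1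
    exact (List.isChain_append.1 h1).2.1
  · have h2 := h.2
    simpa [List.getLast_cons, List.getLast_append] using h2

/-- If `a`, `b`, `c` are walks of length at most `k` with the same ends, with `a ≠ b` and `b ≠ c`,
then `a = c`. -/
theorem eq_of_short_walks {d k : ℕ} (M : AlmostMooreDigraph d k) {u w : M.V}
    {a b c : List M.V} (ha : IsWalkFrom M.Adj u w a ∧ a.length ≤ k)
    (hb : IsWalkFrom M.Adj u w b ∧ b.length ≤ k) (hc : IsWalkFrom M.Adj u w c ∧ c.length ≤ k)
    (hab : a ≠ b) (hbc : b ≠ c) : a = c := by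
  by_cases hw : w = M.rep u
  · subst hw
    obtain ⟨l₁, l₂, -, -, -, -, -, -, h⟩ := M.rep_two u
    have h1 := h a ha.1 ha.2
    have h2 := h b hb.1 hb.2
    have h3 := h c hc.1 hc.2
    grind
  · exact (M.rep_spec u w hw).unique ha hc

/-- If an iterate of `rep` fixes both ends of a walk of length at most `k`, then its square
fixes every vertex of the walk. -/
theorem isPeriodicPt_of_mem_walk {d k : ℕ} (M : AlmostMooreDigraph d k) {m : ℕ} {u w x : M.V}
    {l : List M.V} (hl : IsWalkFrom M.Adj u w l) (hk : l.length ≤ k)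
    (hu : M.rep^[m] u = u) (hw : M.rep^[m] w = w) (hx : x ∈ l) :
    Function.IsPeriodicPt M.rep (2 * m) x := by
  set f := M.rep^[m] with hf
  have hadj : ∀ a b, M.Adj a b → M.Adj (f a) (f b) := by
    intro a b hab
    rw [hf]
    clear hf hu hw
    induction m with
    | zero => exact hab
    | succ n ih =>
      rw [Function.iterate_succ_apply', Function.iterate_succ_apply']
      exact (M.rep_adj _ _).1 ih
  have step : ∀ {l : List M.V}, IsWalkFrom M.Adj u w l → IsWalkFrom M.Adj u w (l.map f) := by
    intro l h
    have := h.map hadj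
    rwa [hu, hw] at this
  have hinj : Function.Injective (List.map f) :=
    List.map_injective_iff.2 (M.rep_bijective.injective.iterate m)
  have key : (l.map f).map f = l := by
    by_cases h : l = l.map f
    · rw [← h, ← h]
    · exact (eq_of_short_walks M ⟨hl, hk⟩ ⟨step hl, by simpa using hk⟩
        ⟨step (step hl), by simpa using hk⟩ h (fun e => h (hinj e))).symm
  have hfx : f (f x) = x := by
    have : l.map (f ∘ f) = l.map id := by simpa using key
    exact List.map_inj_left.1 this x hx
  rw [two_mul, Function.IsPeriodicPt, Function.IsFixedPt, Function.iterate_add_apply]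
  exact hfx

theorem mem_Hset_of_mem_walk {d k : ℕ} (M : AlmostMooreDigraph d k) {α : ℕ} {u w x : M.V}
    {l : List M.V} (hl : IsWalkFrom M.Adj u w l) (hk : l.length ≤ k)
    (hu : u ∈ Hset M α) (hw : w ∈ Hset M α) (hx : x ∈ l) : x ∈ Hset M α := by
  obtain ⟨t, htu, htw⟩ := exists_common_period M hu hw
  refine (mem_Hset_iff M x).2 ⟨t + 1, ?_⟩
  have := isPeriodicPt_of_mem_walk M hl hk htu htw hx
  rwa [pow_succ', mul_assoc]

/-- Let `v ∈ H_α`, let `vⱼ` be an out-neighbour of `v`, and let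
`T(vⱼ)` be the set of vertices `w` such that some shortest walk from `v` to `w` passes
through `vⱼ`.  If `(z, v)` is an arc with `z ∈ T(vⱼ)`, then `vⱼ ∈ H_α ↔ z ∈ H_α`. -/
theorem stmt2 {d k : ℕ} (M : AlmostMooreDigraph d k) (α : ℕ) (hα : 1 < α)
    (v : M.V) (hv : v ∈ Hset M α) (vj : M.V) (hvj : M.Adj v vj)
    (z : M.V) (hz : M.Adj z v)
    (hT : ∃ l : List M.V, IsWalkFrom M.Adj v z l ∧ l.length = distG M v z ∧ vj ∈ v :: l) :
    vj ∈ Hset M α ↔ z ∈ Hset M α := by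
  obtain ⟨l, hl, hlen, hmem⟩ := hT
  have hne : vj ≠ v := fun h => M.loopless v (h ▸ hvj)
  have hvjl : vj ∈ l := (List.mem_cons.1 hmem).resolve_left hne
  have hlk : l.length ≤ k := by
    obtain ⟨p, hp, hpk⟩ := M.reach v z
    have hdist : distG M v z ≤ p.length := Nat.sInf_le ⟨p, hp, rfl⟩
    omega
  refine ⟨fun hj => ?_, fun hzH => mem_Hset_of_mem_walk M hl hlk hv hzH hvjl⟩
  obtain ⟨s, t, rfl⟩ := List.append_of_mem hvjl
  have ht : IsWalkFrom M.Adj vj z t := hl.suffix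
  have htk : (t ++ [v]).length ≤ k := by
    simp only [List.length_append, List.length_cons, List.length_nil] at hlk ⊢
    omega
  have hzt : z ∈ vj :: t := by
    have := List.getLast_mem (List.cons_ne_nil vj t)
    rwa [ht.2] at this
  rcases List.mem_cons.1 hzt with rfl | hzt
  · exact hj
  · exact mem_Hset_of_mem_walk M (ht.concat hz) htk hj hv (List.mem_append_left _ hzt)
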